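/- arXiv:0807.1963 — 2 statements merged into one kernel-verified Lean document; each statement's English description precedes it below -/
import Mathlib

section
/- (Mecke-type identity, creation direction.) Let (X, 𝒳, ν) be a measurable space with all singletons measurable and ν a finite diffuse measure with 0 < ν(X) < ∞, and let (Ω₀, P₀) be the concrete Poisson space with intensity ν, with configuration map N: Ω₀ → (measures on X), N(n, x_1, x_2, …) = Σ_{i=1}^n δ_{x_i}. Then for every measurable H: (measures on X) × X → [0,∞] (with the canonical measurable structure on the space of measures): ∫_{Ω₀} ∫_X H(N_ω + δ_x, x) ν(dx) P₀(dω) = ∫_{Ω₀} ∫_X H(N_ω, x) N_ω(dx) P₀(dω). -/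
open MeasureTheory Set Finset
open scoped ENNReal

noncomputable section

/-- The Poisson law with parameter `t` on `ℕ` : `P({n}) = e^{−t} tⁿ / n!`. -/
def poissonLaw (t : ℝ) : Measure ℕ :=
  Measure.sum fun n =>
    (ENNReal.ofReal (Real.exp (-t) * t ^ n / n.factorial)) • Measure.dirac n

/-- `N(f)(ω) = Σ_{i=1}^n f(x_i)` for a point `ω = (n, x₁, x₂, …)` of the concrete
Poisson space `Ω₀ = ℕ × X^{ℕ*}` (empty sum = 0). -/
def NN {X : Type*} (f : X → ℝ) (ω : ℕ × (ℕ → X)) : ℝ :=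
  ∑ i ∈ Finset.range ω.1, f (ω.2 i)

/-- The σ-field `𝒜 = σ(N(1_A) : A ∈ 𝒳)` on the concrete Poisson space `Ω₀`. -/
def poissonSigmaAlgebra (X : Type*) [MeasurableSpace X] :
    MeasurableSpace (ℕ × (ℕ → X)) :=
  ⨆ (A : Set X) (_ : MeasurableSet A),
    MeasurableSpace.comap (NN (A.indicator fun _ => (1 : ℝ))) inferInstance

/-- The concrete Poisson probability `P₀` with finite intensity `ν` on `Ω₀ = ℕ × X^{ℕ*}`:
the product of the Poisson law of parameter `ν(X)` with the infinite product `Pseq` of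
countably many copies of the normalized measure `ν/ν(X)`. -/
def poissonP0 {X : Type*} [MeasurableSpace X] (ν : Measure X)
    (Pseq : Measure (ℕ → X)) : Measure (ℕ × (ℕ → X)) :=
  (poissonLaw (ν univ).toReal).prod Pseq

/-- `Pseq` is the infinite product of copies of the normalized measure `ν/ν(X)`,
characterized by its values on measurable cylinders. -/
def IsProductOfNormalized {X : Type*} [MeasurableSpace X] (ν : Measure X)
    (Pseq : Measure (ℕ → X)) : Prop :=
  IsProbabilityMeasure Pseq ∧
  ∀ (s : Finset ℕ) (A : ℕ → Set X), (∀ i, MeasurableSet (A i)) →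
    Pseq {x | ∀ i ∈ s, x i ∈ A i} = ∏ i ∈ s, ((ν univ)⁻¹ * ν (A i))

/-- The configuration (point measure) `N_ω = Σ_{i=1}^n δ_{x_i}` associated to a point
`ω = (n, x₁, x₂, …)` of the concrete Poisson space. -/
def configMeasure {X : Type*} [MeasurableSpace X] (ω : ℕ × (ℕ → X)) : Measure X :=
  ∑ i ∈ Finset.range ω.1, Measure.dirac (ω.2 i)

/-- Integration against `poissonP0` is a series over the number of points. -/
lemma lintegral_poissonP0 {X : Type*} [MeasurableSpace X] (ν : Measure X)
    (Pseq : Measure (ℕ → X)) [SFinite Pseq] (f : ℕ × (ℕ → X) → ℝ≥0∞)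
    (hf : ∀ n, Measurable fun x => f (n, x)) :
    ∫⁻ ω, f ω ∂(poissonP0 ν Pseq) =
      ∑' n : ℕ, ENNReal.ofReal
        (Real.exp (-(ν univ).toReal) * (ν univ).toReal ^ n / n.factorial) *
          ∫⁻ x, f (n, x) ∂Pseq := by
  have hf' : Measurable f := measurable_from_prod_countable_right hf
  rw [poissonP0, lintegral_prod _ hf'.aemeasurable, poissonLaw, lintegral_sum_measure]
  simp only [lintegral_smul_measure, lintegral_dirac, smul_eq_mul]

/-- The weights of the Poisson law satisfy `(n + 1) p_{n+1} = t p_n`. -/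
lemma poisson_weight_succ (t : ℝ) (ht : 0 ≤ t) (n : ℕ) :
    ENNReal.ofReal (Real.exp (-t) * t ^ (n + 1) / (n + 1).factorial) * (n + 1 : ℕ) =
      ENNReal.ofReal (Real.exp (-t) * t ^ n / n.factorial) * ENNReal.ofReal t := by
  rw [← ENNReal.ofReal_natCast, ← ENNReal.ofReal_mul (by positivity),
    ← ENNReal.ofReal_mul (by positivity)]
  congr 1
  rw [Nat.factorial_succ]
  push_cast
  have : ((n : ℝ) + 1) ≠ 0 := by positivity
  field_simp
  ring

/-- The product condition identifies the sequence law with `Measure.infinitePi`. -/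
lemma IsProductOfNormalized.eq_infinitePi {X : Type*} [MeasurableSpace X] {ν : Measure X}
    [IsProbabilityMeasure ((ν univ)⁻¹ • ν)]
    {Pseq : Measure (ℕ → X)} (h : IsProductOfNormalized ν Pseq) :
    Pseq = Measure.infinitePi fun _ : ℕ => (ν univ)⁻¹ • ν := by
  refine Measure.eq_infinitePi _ fun s A hA => ?_
  simpa [Set.pi] using h.2 s A hA

lemma measurable_update_prod {ι X : Type*} [DecidableEq ι] [MeasurableSpace X] (i : ι) :
    Measurable fun p : (ι → X) × X => Function.update p.1 i p.2 := by
  rw [measurable_pi_iff]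
  intro j
  by_cases hj : j = i
  · subst hj
    simpa using measurable_snd
  · simp only [Function.update_of_ne hj]
    fun_prop

/-- Resampling one coordinate preserves an infinite product measure. -/
lemma infinitePi_prod_map_update {ι X : Type*} [DecidableEq ι] [MeasurableSpace X]
    (μ : Measure X) [IsProbabilityMeasure μ] (i : ι) :
    ((Measure.infinitePi fun _ : ι => μ).prod μ).map
        (fun p => Function.update p.1 i p.2) = Measure.infinitePi fun _ : ι => μ := by
  refine Measure.eq_infinitePi _ fun s A hA => ?_
  have hm := measurable_update_prod (X := X) i
  rw [Measure.map_apply hm (MeasurableSet.pi s.countable_toSet fun j _ => hA j)]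
  have hset : (fun p : (ι → X) × X => Function.update p.1 i p.2) ⁻¹' (s : Set ι).pi A =
      ((s.erase i : Finset ι) : Set ι).pi A ×ˢ (if i ∈ s then A i else univ) := by
    ext ⟨x, y⟩
    simp only [Set.mem_preimage, Set.mem_pi, Set.mem_prod, Finset.mem_coe, Finset.mem_erase]
    constructor
    · refine fun h => ⟨fun j hj => by simpa [hj.1] using h j hj.2, ?_⟩
      split_ifs with hi
      · simpa using h i hi
      · trivial
    · rintro ⟨h, hy⟩ j hj
      by_cases hji : j = i
      · subst hji
        simpa [hj] using hy
      · simpa [hji] using h j ⟨hji, hj⟩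
  rw [hset, Measure.prod_prod, Measure.infinitePi_pi _ fun j _ => hA j]
  split_ifs with hi
  · exact Finset.prod_erase_mul s _ hi
  · simp [Finset.erase_eq_of_notMem hi]

/-- Permuting the coordinates preserves an infinite product of identical measures. -/
lemma infinitePi_map_comp_equiv {ι X : Type*} [MeasurableSpace X]
    (μ : Measure X) [IsProbabilityMeasure μ] (e : Equiv.Perm ι) :
    (Measure.infinitePi fun _ : ι => μ).map (fun x => x ∘ e) =
      Measure.infinitePi fun _ : ι => μ := by
  classical
  refine Measure.eq_infinitePi _ fun s A hA => ?_
  have hm : Measurable fun x : ι → X => x ∘ e :=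
    measurable_pi_iff.2 fun j => measurable_pi_apply (e j)
  rw [Measure.map_apply hm (MeasurableSet.pi s.countable_toSet fun j _ => hA j)]
  have hset : (fun x : ι → X => x ∘ e) ⁻¹' (s : Set ι).pi A =
      ((s.map e.toEmbedding : Finset ι) : Set ι).pi fun j => A (e.symm j) := by
    ext x
    simp only [Set.mem_preimage, Set.mem_pi, Finset.mem_coe, Function.comp_apply, Finset.mem_map,
      Equiv.coe_toEmbedding, forall_exists_index, and_imp, forall_apply_eq_imp_iff₂,
      Equiv.symm_apply_apply]
  rw [hset, Measure.infinitePi_pi _ fun j _ => hA _, Finset.prod_map]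
  simp

lemma measurable_configMeasure {X : Type*} [MeasurableSpace X] (n : ℕ) :
    Measurable fun x : ℕ → X => configMeasure (n, x) := by
  refine Measure.measurable_of_measurable_coe _ fun s hs => ?_
  simp only [configMeasure, Measure.finsetSum_apply]
  exact Finset.measurable_sum _ fun i _ =>
    (Measure.measurable_coe hs).comp (Measure.measurable_dirac.comp (measurable_pi_apply i))

lemma measurable_configMeasure_add_dirac {X : Type*} [MeasurableSpace X] (n : ℕ) :
    Measurable fun p : (ℕ → X) × X => configMeasure (n, p.1) + Measure.dirac p.2 := by
  refine Measure.measurable_of_measurable_coe _ fun s hs => ?_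
  simp only [Measure.add_apply]
  exact ((Measure.measurable_coe hs).comp
    ((measurable_configMeasure n).comp measurable_fst)).add
      ((Measure.measurable_coe hs).comp (Measure.measurable_dirac.comp measurable_snd))

lemma configMeasure_succ_update {X : Type*} [MeasurableSpace X] (n : ℕ) (x : ℕ → X) (y : X) :
    configMeasure (n + 1, Function.update x n y) = configMeasure (n, x) + Measure.dirac y := by
  simp only [configMeasure, Finset.sum_range_succ, Function.update_self]
  congr 1
  refine Finset.sum_congr rfl fun i hi => ?_
  rw [Function.update_of_ne (Finset.mem_range.1 hi).ne]

lemma configMeasure_comp_swap {X : Type*} [MeasurableSpace X] {n i j : ℕ} (hi : i < n)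
    (hj : j < n) (x : ℕ → X) :
    configMeasure (n, x ∘ Equiv.swap i j) = configMeasure (n, x) := by
  refine Finset.sum_equiv (Equiv.swap i j) (fun k => ?_) fun k _ => rfl
  simp only [Finset.mem_range, Equiv.swap_apply_def]
  split_ifs <;> simp_all

/-- The integral against a configuration of `n` points is a finite sum. -/
lemma lintegral_configMeasure {X : Type*} [MeasurableSpace X] [MeasurableSingletonClass X]
    (f : X → ℝ≥0∞) (n : ℕ) (x : ℕ → X) :
    ∫⁻ y, f y ∂(configMeasure (n, x)) = ∑ i ∈ Finset.range n, f (x i) := by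
  simp [configMeasure]

/-- Conditionally on having `n + 1` points, integrating against the configuration amounts to
adding an independent point to a configuration of `n` points, `n + 1` times. -/
lemma lintegral_configMeasure_succ {X : Type*} [MeasurableSpace X] [MeasurableSingletonClass X]
    (μ : Measure X) [IsProbabilityMeasure μ] (H : Measure X × X → ℝ≥0∞) (hH : Measurable H)
    (n : ℕ) :
    ∫⁻ x, (∫⁻ y, H (configMeasure (n + 1, x), y) ∂(configMeasure (n + 1, x)))
        ∂(Measure.infinitePi fun _ : ℕ => μ) =
      (n + 1 : ℕ) * ∫⁻ x, (∫⁻ y, H (configMeasure (n, x) + Measure.dirac y, y) ∂μ)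
        ∂(Measure.infinitePi fun _ : ℕ => μ) := by
  have hm (i : ℕ) : Measurable fun x : ℕ → X => H (configMeasure (n + 1, x), x i) :=
    hH.comp ((measurable_configMeasure _).prodMk (measurable_pi_apply i))
  have hlast (i : ℕ) (hi : i ∈ Finset.range (n + 1)) :
      ∫⁻ x, H (configMeasure (n + 1, x), x i) ∂(Measure.infinitePi fun _ : ℕ => μ) =
        ∫⁻ x, H (configMeasure (n + 1, x), x n) ∂(Measure.infinitePi fun _ : ℕ => μ) := by
    conv_lhs => rw [← infinitePi_map_comp_equiv μ (Equiv.swap i n)]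
    rw [lintegral_map (hm i) (measurable_pi_iff.2 fun j => measurable_pi_apply _)]
    simp [configMeasure_comp_swap (Finset.mem_range.1 hi) n.lt_succ_self]
  have hupd : Measurable fun p : (ℕ → X) × X => Function.update p.1 n p.2 :=
    measurable_update_prod n
  simp only [lintegral_configMeasure]
  rw [lintegral_finsetSum _ fun i _ => hm i, Finset.sum_congr rfl hlast, Finset.sum_const,
    Finset.card_range, nsmul_eq_mul]
  congr 1
  conv_lhs => rw [← infinitePi_prod_map_update μ n]
  rw [lintegral_map (hm n) hupd]
  simp only [configMeasure_succ_update, Function.update_self]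
  exact lintegral_prod _
    (hH.comp ((measurable_configMeasure_add_dirac n).prodMk measurable_snd)).aemeasurable

/-- **Mecke-type identity, creation direction.** On the concrete Poisson
space with finite diffuse intensity `ν`, for every measurable
`H : (measures on X) × X → [0,∞]` :
`E ∫ H(N + δ_x, x) ν(dx) = E ∫ H(N, x) N(dx)`. -/
theorem mecke_creation {X : Type*} [MeasurableSpace X] [MeasurableSingletonClass X]
    (ν : Measure X) [IsFiniteMeasure ν] (hpos : 0 < ν univ)
    (hdiffuse : ∀ x : X, ν {x} = 0)
    (Pseq : Measure (ℕ → X)) (hPseq : IsProductOfNormalized ν Pseq)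
    (H : Measure X × X → ℝ≥0∞) (hH : Measurable H) :
    ∫⁻ ω, (∫⁻ x, H (configMeasure ω + Measure.dirac x, x) ∂ν) ∂(poissonP0 ν Pseq) =
      ∫⁻ ω, (∫⁻ x, H (configMeasure ω, x) ∂(configMeasure ω)) ∂(poissonP0 ν Pseq) := by
  have hν : ν univ ≠ ∞ := measure_ne_top ν univ
  have : IsProbabilityMeasure ((ν univ)⁻¹ • ν) :=
    ⟨by simpa using ENNReal.inv_mul_cancel hpos.ne' hν⟩
  have hscale (f : X → ℝ≥0∞) :
      ∫⁻ x, f x ∂ν = ν univ * ∫⁻ x, f x ∂((ν univ)⁻¹ • ν) := by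
    rw [lintegral_smul_measure, smul_eq_mul, ← mul_assoc, ENNReal.mul_inv_cancel hpos.ne' hν,
      one_mul]
  have := hPseq.1
  have hadd (n : ℕ) : Measurable fun p : (ℕ → X) × X =>
      H (configMeasure (n, p.1) + Measure.dirac p.2, p.2) :=
    hH.comp ((measurable_configMeasure_add_dirac n).prodMk measurable_snd)
  have hsum (n : ℕ) : Measurable fun x : ℕ → X =>
      ∫⁻ y, H (configMeasure (n, x), y) ∂(configMeasure (n, x)) := by
    simp only [lintegral_configMeasure]
    exact Finset.measurable_sum _ fun i _ =>
      hH.comp ((measurable_configMeasure _).prodMk (measurable_pi_apply i))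
  rw [lintegral_poissonP0 ν Pseq _ fun n => (hadd n).lintegral_prod_right',
    lintegral_poissonP0 ν Pseq _ hsum]
  conv_rhs => rw [tsum_eq_zero_add' ENNReal.summable]
  have hzero (x : ℕ → X) : configMeasure (0, x) = 0 := by simp [configMeasure]
  simp only [hzero, lintegral_zero_measure, lintegral_zero, mul_zero, zero_add]
  refine tsum_congr fun n => ?_
  rw [hPseq.eq_infinitePi, lintegral_configMeasure_succ _ H hH, ← mul_assoc,
    poisson_weight_succ _ ENNReal.toReal_nonneg, ENNReal.ofReal_toReal hν, mul_assoc]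
  simp only [hscale]
  rw [lintegral_const_mul _ (hadd n).lintegral_prod_right']
end
end

section
/- (Mecke-type identity, annihilation direction.) Let (X, 𝒳, ν) be a measurable space with all singletons measurable and ν a finite diffuse measure with 0 < ν(X) < ∞, and let (Ω₀, P₀) be the concrete Poisson space with intensity ν, with configuration map N: Ω₀ → (measures on X), N(n, x_1, x_2, …) = Σ_{i=1}^n δ_{x_i}. Then for every measurable H: (measures on X) × X → [0,∞]: ∫_{Ω₀} ∫_X H(N_ω − δ_x, x) N_ω(dx) P₀(dω) = ∫_{Ω₀} ∫_X H(N_ω, x) ν(dx) P₀(dω), where N_ω − δ_x denotes the configuration N_ω with the atom at x removed (well defined for N_ω-almost every x). -/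
open MeasureTheory Set Finset
open scoped ENNReal

noncomputable section

namespace MeckeAnnihilation

open Measure

variable {X : Type*} [MeasurableSpace X]

lemma measurable_update_prod {ι : Type*} [DecidableEq ι] (i : ι) :
    Measurable fun p : X × (ι → X) => Function.update p.2 i p.1 := by
  refine measurable_pi_lambda _ fun j => ?_
  by_cases hj : j = i
  · subst hj
    simpa using measurable_fst
  · simp only [Function.update_of_ne hj]
    fun_prop

lemma infinitePi_map_update (μ : Measure X) [IsProbabilityMeasure μ] (i : ℕ) :
    (μ.prod (infinitePi fun _ : ℕ => μ)).map (fun p => Function.update p.2 i p.1) =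
      infinitePi fun _ => μ := by
  refine eq_infinitePi _ fun s t ht => ?_
  rw [map_apply (measurable_update_prod i) (.pi s.countable_toSet fun j _ => ht j)]
  have hpre : (fun p : X × (ℕ → X) => Function.update p.2 i p.1) ⁻¹' (s : Set ℕ).pi t =
      (if i ∈ s then t i else univ) ×ˢ ((s.erase i : Finset ℕ) : Set ℕ).pi t := by
    ext ⟨x, y⟩
    simp only [Set.mem_preimage, Set.mem_pi, Set.mem_prod, SetLike.mem_coe, Finset.mem_erase]
    refine ⟨fun h => ⟨?_, fun j hj => ?_⟩, fun h j hj => ?_⟩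
    · split_ifs with hi
      · simpa using h i hi
      · trivial
    · simpa [Function.update_of_ne hj.1] using h j hj.2
    · by_cases hji : j = i
      · subst hji
        simpa [hj] using h.1
      · simpa [Function.update_of_ne hji] using h.2 j ⟨hji, hj⟩
  rw [hpre, prod_prod, infinitePi_pi _ fun j _ => ht j]
  split_ifs with hi
  · exact Finset.mul_prod_erase s (fun j => μ (t j)) hi
  · simp [Finset.erase_eq_of_notMem hi]

lemma infinitePi_map_comp_equiv {ι : Type*} (μ : Measure X) [IsProbabilityMeasure μ]
    (σ : Equiv.Perm ι) :
    (infinitePi fun _ : ι => μ).map (fun y j => y (σ j)) = infinitePi fun _ => μ := by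
  refine eq_infinitePi _ fun s t ht => ?_
  rw [map_apply (by fun_prop) (.pi s.countable_toSet fun j _ => ht j)]
  have hpre : (fun (y : ι → X) j => y (σ j)) ⁻¹' (s : Set ι).pi t =
      ((s.map σ.toEmbedding : Finset ι) : Set ι).pi fun k => t (σ.symm k) := by
    ext y
    refine ⟨fun h k hk => ?_, fun h j hj => ?_⟩
    · obtain ⟨j, hj, rfl⟩ := Finset.mem_map.1 hk
      simpa using h j hj
    · simpa using h (σ j) (Finset.mem_map_of_mem _ hj)
  rw [hpre, infinitePi_pi _ fun j _ => ht _]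
  simp

lemma measurable_sum_dirac (s : Finset ℕ) :
    Measurable fun y : ℕ → X => ∑ j ∈ s, dirac (y j) :=
  Finset.measurable_fun_sum s fun j _ => measurable_dirac.comp (measurable_pi_apply j)

/-- Under an i.i.d. sequence, one of the first `n + 1` points together with the point measure
of the others is distributed as an independent point with the measure of the first `n` points. -/
lemma lintegral_sum_dirac_erase (μ : Measure X) [IsProbabilityMeasure μ]
    {H : Measure X × X → ℝ≥0∞} (hH : Measurable H) {n i : ℕ} (hi : i ∈ range (n + 1)) :
    ∫⁻ y, H (∑ j ∈ (range (n + 1)).erase i, dirac (y j), y i) ∂(infinitePi fun _ : ℕ => μ) =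
      ∫⁻ x, ∫⁻ y, H (∑ j ∈ range n, dirac (y j), x) ∂(infinitePi fun _ : ℕ => μ) ∂μ := by
  have hsum (s : Finset ℕ) : Measurable fun p : X × (ℕ → X) =>
      H (∑ j ∈ s, dirac (p.2 j), p.1) :=
    hH.comp (((measurable_sum_dirac s).comp measurable_snd).prodMk measurable_fst)
  have hterm : Measurable fun y : ℕ → X =>
      H (∑ j ∈ (range (n + 1)).erase i, dirac (y j), y i) :=
    hH.comp ((measurable_sum_dirac _).prodMk (measurable_pi_apply i))
  conv_lhs => rw [← infinitePi_map_update μ i, lintegral_map hterm (measurable_update_prod i)]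
  have hcongr (p : X × (ℕ → X)) : H (∑ j ∈ (range (n + 1)).erase i,
      dirac (Function.update p.2 i p.1 j), Function.update p.2 i p.1 i) =
      H (∑ j ∈ (range (n + 1)).erase i, dirac (p.2 j), p.1) := by
    rw [Function.update_self]
    congr 2
    refine Finset.sum_congr rfl fun j hj => ?_
    rw [Function.update_of_ne (Finset.ne_of_mem_erase hj)]
  simp_rw [hcongr]
  rw [lintegral_prod _ (hsum _).aemeasurable]
  refine lintegral_congr fun x => ?_
  conv_rhs => rw [← infinitePi_map_comp_equiv μ (Equiv.swap i n)]
  have hx : Measurable fun y : ℕ → X => H (∑ j ∈ range n, dirac (y j), x) :=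
    hH.comp ((measurable_sum_dirac _).prodMk measurable_const)
  rw [lintegral_map hx (by fun_prop)]
  refine lintegral_congr fun y => ?_
  congr 2
  symm
  refine Finset.sum_bij (fun j _ => Equiv.swap i n j) ?_ ?_ ?_ ?_
  · intro j hj
    simp only [Finset.mem_range, Finset.mem_erase] at *
    rw [Equiv.swap_apply_def]
    split_ifs <;> omega
  · intro j _ k _ h
    exact (Equiv.swap i n).injective h
  · intro k hk
    refine ⟨Equiv.swap i n k, ?_, by simp⟩
    simp only [Finset.mem_range, Finset.mem_erase] at *
    rw [Equiv.swap_apply_def]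
    split_ifs <;> omega
  · intro j _
    rfl

lemma lintegral_poissonP0 (ν : Measure X) (P : Measure (ℕ → X)) [SFinite P]
    {f : ℕ × (ℕ → X) → ℝ≥0∞} (hf : ∀ n, Measurable fun y => f (n, y)) :
    ∫⁻ ω, f ω ∂(poissonP0 ν P) =
      ∑' n : ℕ, ENNReal.ofReal
        (Real.exp (-(ν univ).toReal) * (ν univ).toReal ^ n / n.factorial) *
          ∫⁻ y, f (n, y) ∂P := by
  rw [poissonP0, lintegral_prod _ (measurable_from_prod_countable_right hf).aemeasurable,
    poissonLaw, lintegral_sum_measure]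
  simp [lintegral_smul_measure]

lemma lintegral_configMeasure_sub_dirac [MeasurableSingletonClass X]
    (H : Measure X × X → ℝ≥0∞) (ω : ℕ × (ℕ → X)) :
    ∫⁻ x, H (configMeasure ω - dirac x, x) ∂(configMeasure ω) =
      ∑ i ∈ range ω.1, H (∑ j ∈ (range ω.1).erase i, dirac (ω.2 j), ω.2 i) := by
  conv_lhs => rw [configMeasure, lintegral_finsetSum_measure]
  refine Finset.sum_congr rfl fun i hi => ?_
  rw [lintegral_dirac, ← Finset.sum_erase_add _ _ hi, Measure.add_sub_cancel]

lemma IsProductOfNormalized.eq_infinitePi {ν : Measure X} {P : Measure (ℕ → X)}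
    (hP : IsProductOfNormalized ν P) [IsProbabilityMeasure ((ν univ)⁻¹ • ν)] :
    P = infinitePi fun _ => (ν univ)⁻¹ • ν :=
  Measure.eq_infinitePi _ fun s t ht => hP.2 s t ht

lemma ofReal_poisson_succ_mul {t : ℝ} (ht : 0 < t) (n : ℕ) :
    ENNReal.ofReal (Real.exp (-t) * t ^ (n + 1) / (n + 1).factorial) * (n + 1 : ℕ) =
      ENNReal.ofReal (Real.exp (-t) * t ^ n / n.factorial) * ENNReal.ofReal t := by
  rw [← ENNReal.ofReal_natCast, ← ENNReal.ofReal_mul (by positivity),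
    ← ENNReal.ofReal_mul (by positivity), Nat.factorial_succ]
  congr 1
  push_cast
  field_simp
  ring

end MeckeAnnihilation

/-- **Mecke-type identity, annihilation direction.** On the concrete
Poisson space with finite diffuse intensity `ν`, for every measurable
`H : (measures on X) × X → [0,∞]` :
`E ∫ H(N − δ_x, x) N(dx) = E ∫ H(N, x) ν(dx)`, where `N − δ_x` is the configuration with
the atom at `x` removed (measure-theoretic truncated subtraction, which removes the atom
for `N`-almost every `x` since the atoms are a.s. pairwise distinct). -/
theorem mecke_annihilation {X : Type*} [MeasurableSpace X] [MeasurableSingletonClass X]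
    (ν : Measure X) [IsFiniteMeasure ν] (hpos : 0 < ν univ)
    (hdiffuse : ∀ x : X, ν {x} = 0)
    (Pseq : Measure (ℕ → X)) (hPseq : IsProductOfNormalized ν Pseq)
    (H : Measure X × X → ℝ≥0∞) (hH : Measurable H) :
    ∫⁻ ω, (∫⁻ x, H (configMeasure ω - Measure.dirac x, x) ∂(configMeasure ω))
        ∂(poissonP0 ν Pseq) =
      ∫⁻ ω, (∫⁻ x, H (configMeasure ω, x) ∂ν) ∂(poissonP0 ν Pseq) := by
  have hfin : ν univ ≠ ∞ := measure_ne_top ν univ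
  have hmul : ν univ * (ν univ)⁻¹ = 1 := ENNReal.mul_inv_cancel hpos.ne' hfin
  have : IsProbabilityMeasure ((ν univ)⁻¹ • ν) := ⟨by simpa [mul_comm] using hmul⟩
  obtain rfl := MeckeAnnihilation.IsProductOfNormalized.eq_infinitePi hPseq
  set μ := (ν univ)⁻¹ • ν with hμ
  have hmeas (n : ℕ) : Measurable fun p : X × (ℕ → X) =>
      H (∑ j ∈ Finset.range n, Measure.dirac (p.2 j), p.1) :=
    hH.comp (((MeckeAnnihilation.measurable_sum_dirac _).comp measurable_snd).prodMk
      measurable_fst)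
  have hterm (n i : ℕ) : Measurable fun y : ℕ → X =>
      H (∑ j ∈ (Finset.range n).erase i, Measure.dirac (y j), y i) :=
    hH.comp ((MeckeAnnihilation.measurable_sum_dirac _).prodMk (measurable_pi_apply i))
  simp_rw [MeckeAnnihilation.lintegral_configMeasure_sub_dirac]
  rw [MeckeAnnihilation.lintegral_poissonP0 ν _
      (fun n => Finset.measurable_fun_sum (Finset.range n) fun i _ => hterm n i),
    MeckeAnnihilation.lintegral_poissonP0 ν _ (fun n => (hmeas n).lintegral_prod_left'),
    tsum_eq_zero_add' ENNReal.summable]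
  simp only [Finset.range_zero, Finset.sum_empty, lintegral_zero, mul_zero, zero_add]
  refine tsum_congr fun n => ?_
  rw [lintegral_finsetSum _ fun i _ => hterm (n + 1) i,
    Finset.sum_congr rfl fun i hi => MeckeAnnihilation.lintegral_sum_dirac_erase μ hH hi,
    Finset.sum_const, Finset.card_range, nsmul_eq_mul, ← mul_assoc,
    MeckeAnnihilation.ofReal_poisson_succ_mul (ENNReal.toReal_pos hpos.ne' hfin),
    ENNReal.ofReal_toReal hfin, mul_assoc, lintegral_lintegral_swap (hmeas n).aemeasurable,
    ← lintegral_const_mul _ (hmeas n).lintegral_prod_left']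
  congr 1
  refine lintegral_congr fun y => ?_
  rw [hμ, lintegral_smul_measure, smul_eq_mul, ← mul_assoc, hmul, one_mul]
  rfl
end
end
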